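/- arXiv:0803.0417 — 6 statements merged into one kernel-verified Lean document; each statement's English description precedes it below -/
import Mathlib

section
/- Let L be a complete lattice and let K ⊆ L be a subset that is closed under arbitrary infima (sInf S ∈ K for every S ⊆ K; in particular ⊤ = sInf ∅ ∈ K) and under binary joins (k₁ ⊔ k₂ ∈ K whenever k₁, k₂ ∈ K). Then outer daseinisation to K preserves binary joins: for all a, b ∈ L, δᵒ_K(a ⊔ b) = δᵒ_K(a) ⊔ δᵒ_K(b). -/
/-- Outer daseinisation of `a` to `K` in a complete lattice:
`δᵒ_K(a) := sInf {k ∈ K | a ≤ k}`. -/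
def outerDas {L : Type*} [CompleteLattice L] (K : Set L) (a : L) : L :=
  sInf {k ∈ K | a ≤ k}

theorem le_outerDas {L : Type*} [CompleteLattice L] (K : Set L) (a : L) :
    a ≤ outerDas K a :=
  le_sInf fun _ hk => hk.2

theorem outerDas_le {L : Type*} [CompleteLattice L] {K : Set L} {a k : L}
    (hk : k ∈ K) (hak : a ≤ k) : outerDas K a ≤ k :=
  sInf_le ⟨hk, hak⟩

theorem outerDas_mono {L : Type*} [CompleteLattice L] (K : Set L) : Monotone (outerDas K) :=
  fun _ _ hab => sInf_le_sInf fun _ hk => ⟨hk.1, hab.trans hk.2⟩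

theorem outerDas_mem {L : Type*} [CompleteLattice L] {K : Set L}
    (hInf : ∀ S : Set L, S ⊆ K → sInf S ∈ K) (a : L) : outerDas K a ∈ K :=
  hInf _ fun _ hk => hk.1

/-- If `K ⊆ L` is closed under arbitrary infima and binary joins, then outer
daseinisation to `K` preserves binary joins. -/
theorem outerDas_sup {L : Type*} [CompleteLattice L] (K : Set L)
    (hInf : ∀ S : Set L, S ⊆ K → sInf S ∈ K)
    (hSup : ∀ k₁ ∈ K, ∀ k₂ ∈ K, k₁ ⊔ k₂ ∈ K) :
    ∀ a b : L, outerDas K (a ⊔ b) = outerDas K a ⊔ outerDas K b := by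
  intro a b
  exact le_antisymm
    (outerDas_le (hSup _ (outerDas_mem hInf a) _ (outerDas_mem hInf b))
      (sup_le_sup (le_outerDas K a) (le_outerDas K b)))
    ((outerDas_mono K).le_map_sup a b)
end

section
/- Let L be a complete lattice and let 𝒦 be a collection of subsets of L such that every a ∈ L belongs to at least one K ∈ 𝒦. Then for every a ∈ L, a = ⨅_{K ∈ 𝒦} δᵒ_K(a), the infimum over all K ∈ 𝒦 of the outer daseinisations of a. Consequently the map a ↦ (δᵒ_K(a))_{K ∈ 𝒦} is injective: if δᵒ_K(a) = δᵒ_K(b) for every K ∈ 𝒦, then a = b. -/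
theorem outerDas_eq_self {L : Type*} [CompleteLattice L] {K : Set L} {a : L} (ha : a ∈ K) :
    outerDas K a = a :=
  le_antisymm (sInf_le ⟨ha, le_rfl⟩) (le_outerDas K a)

/-- If every element of `L` belongs to at least one `K ∈ 𝒦`, then every `a` is
the infimum over `K ∈ 𝒦` of its outer daseinisations, and consequently the map
`a ↦ (δᵒ_K(a))_{K ∈ 𝒦}` is injective. -/
theorem outerDas_inf_eq_and_injective {L : Type*} [CompleteLattice L]
    (𝒦 : Set (Set L)) (hcov : ∀ a : L, ∃ K ∈ 𝒦, a ∈ K) :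
    (∀ a : L, a = ⨅ K ∈ 𝒦, outerDas K a) ∧
    ∀ a b : L, (∀ K ∈ 𝒦, outerDas K a = outerDas K b) → a = b := by
  have iInf_eq : ∀ a : L, a = ⨅ K ∈ 𝒦, outerDas K a := fun a => by
    obtain ⟨K, hK, ha⟩ := hcov a
    exact le_antisymm (le_iInf₂ fun K _ => le_outerDas K a)
      ((iInf₂_le K hK).trans_eq (outerDas_eq_self ha))
  refine ⟨iInf_eq, fun a b h => ?_⟩
  rw [iInf_eq a, iInf_eq b]
  exact biInf_congr h
end

section
/- Let L be a complete lattice and let 𝒦 be a collection of subsets of L such that every a ∈ L belongs to at least one K ∈ 𝒦. Then for every a ∈ L, a = ⨆_{K ∈ 𝒦} δᶦ_K(a), the supremum over all K ∈ 𝒦 of the inner daseinisations of a. Consequently the map a ↦ (δᶦ_K(a))_{K ∈ 𝒦} is injective: if δᶦ_K(a) = δᶦ_K(b) for every K ∈ 𝒦, then a = b. -/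
/-- Inner daseinisation of `a` to `K` in a complete lattice:
`δᶦ_K(a) := sSup {k ∈ K | k ≤ a}`. -/
def innerDas {L : Type*} [CompleteLattice L] (K : Set L) (a : L) : L :=
  sSup {k ∈ K | k ≤ a}

theorem innerDas_le {L : Type*} [CompleteLattice L] (K : Set L) (a : L) : innerDas K a ≤ a :=
  sSup_le fun _ hk => hk.2

theorem innerDas_eq_self_of_mem {L : Type*} [CompleteLattice L] {K : Set L} {a : L}
    (ha : a ∈ K) : innerDas K a = a :=
  (innerDas_le K a).antisymm (le_sSup ⟨ha, le_rfl⟩)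

theorem eq_iSup_innerDas {L : Type*} [CompleteLattice L] {𝒦 : Set (Set L)}
    (hcov : ∀ a : L, ∃ K ∈ 𝒦, a ∈ K) (a : L) : a = ⨆ K ∈ 𝒦, innerDas K a := by
  obtain ⟨K, hK, ha⟩ := hcov a
  exact ((innerDas_eq_self_of_mem ha).ge.trans (le_iSup₂_of_le K hK le_rfl)).antisymm
    (iSup₂_le fun K _ => innerDas_le K a)

/-- If every element of `L` belongs to at least one `K ∈ 𝒦`, then every `a` is
the supremum over `K ∈ 𝒦` of its inner daseinisations, and consequently the map
`a ↦ (δᶦ_K(a))_{K ∈ 𝒦}` is injective. -/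
theorem innerDas_sup_eq_and_injective {L : Type*} [CompleteLattice L]
    (𝒦 : Set (Set L)) (hcov : ∀ a : L, ∃ K ∈ 𝒦, a ∈ K) :
    (∀ a : L, a = ⨆ K ∈ 𝒦, innerDas K a) ∧
    ∀ a b : L, (∀ K ∈ 𝒦, innerDas K a = innerDas K b) → a = b := by
  refine ⟨eq_iSup_innerDas hcov, fun a b h => ?_⟩
  rw [eq_iSup_innerDas hcov a, eq_iSup_innerDas hcov b]
  exact biSup_congr h
end

section
/- Let L be a complete lattice and let 𝒦 be a collection of subsets of L such that every element of L belongs to at least one K ∈ 𝒦. Then for all a, b ∈ L: a ≤ b if and only if δᵒ_K(a) ≤ δᵒ_K(b) for every K ∈ 𝒦. -/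
/-- If every element of `L` belongs to at least one `K ∈ 𝒦`, then `a ≤ b` holds
iff `δᵒ_K(a) ≤ δᵒ_K(b)` for every `K ∈ 𝒦`: daseinisation respects and reflects
the partial order. -/
theorem le_iff_forall_outerDas_le {L : Type*} [CompleteLattice L]
    (𝒦 : Set (Set L)) (hcov : ∀ x : L, ∃ K ∈ 𝒦, x ∈ K) (a b : L) :
    a ≤ b ↔ ∀ K ∈ 𝒦, outerDas K a ≤ outerDas K b := by
  refine ⟨fun hab K _ => outerDas_mono K hab, fun h => ?_⟩
  obtain ⟨K, hK, hbK⟩ := hcov b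
  exact (le_outerDas K a).trans ((h K hK).trans_eq (outerDas_eq_self hbK))
end

section
/- Let L be a complete lattice and let K ⊆ L be closed under arbitrary suprema (sSup S ∈ K for every S ⊆ K). Let F ⊆ K be an upper set in K, i.e. for all q ∈ F and k ∈ K with q ≤ k one has k ∈ F. Then {a ∈ L | δᶦ_K(a) ∈ F} = 𝒞(F) := {a ∈ L | ∃ q ∈ F, q ≤ a}. In other words, the preimage of F under inner daseinisation equals the cone (upward closure) of F in L. -/
theorem le_innerDas {L : Type*} [CompleteLattice L] {K : Set L} {k a : L} (hk : k ∈ K)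
    (hka : k ≤ a) : k ≤ innerDas K a :=
  le_sSup ⟨hk, hka⟩

/-- If `K` is closed under arbitrary suprema and `F ⊆ K` is an upper set in `K`,
then the preimage of `F` under inner daseinisation is the cone (upward closure)
of `F` in `L`. -/
theorem innerDas_preimage_eq_cone {L : Type*} [CompleteLattice L] (K : Set L)
    (hSup : ∀ S : Set L, S ⊆ K → sSup S ∈ K)
    (F : Set L) (hFK : F ⊆ K)
    (hup : ∀ q ∈ F, ∀ k ∈ K, q ≤ k → k ∈ F) :
    {a : L | innerDas K a ∈ F} = {a : L | ∃ q ∈ F, q ≤ a} := by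
  ext a
  constructor
  · exact fun ha => ⟨innerDas K a, ha, innerDas_le K a⟩
  · rintro ⟨q, hq, hqa⟩
    exact hup q hq _ (hSup _ (Set.sep_subset K _)) (le_innerDas (hFK hq) hqa)
end

section
/- Let P be a partially ordered set and f : P → ℝ. Suppose that for every p ∈ P the variations of f along finite strictly increasing chains ending at p are bounded above: there exists M_p ∈ ℝ such that for every n ≥ 1 and every strictly increasing c : {0, 1, …, n} → P with c(n) = p, one has ∑_{j=1}^n |f(c(j)) − f(c(j−1))| ≤ M_p. Then f is the difference of two antitone functions: there exist ν, κ : P → ℝ antitone with f = ν − κ. (Explicitly, letting I_f(p) be the supremum of these variations, the function I_f is monotone, f − I_f is antitone, and f = (f − I_f) − (−I_f).) -/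
/-- The variations of `f` along finite strictly increasing chains ending at `p`,
including the trivial chain `p`. -/
def chainVariations {P : Type*} [Preorder P] (f : P → ℝ) (p : P) : Set ℝ :=
  {v | ∃ (n : ℕ) (c : ℕ → P), (∀ i < n, c i < c (i + 1)) ∧ c n = p ∧
    ∑ j ∈ Finset.range n, |f (c (j + 1)) - f (c j)| = v}

theorem zero_mem_chainVariations {P : Type*} [Preorder P] (f : P → ℝ) (p : P) :
    0 ∈ chainVariations f p :=
  ⟨0, fun _ => p, by simp, rfl, by simp⟩

/-- A chain ending at `p` extends to any `q > p`. -/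
theorem add_abs_sub_mem_chainVariations {P : Type*} [Preorder P] {f : P → ℝ} {p q : P}
    (hpq : p < q) {v : ℝ} (hv : v ∈ chainVariations f p) :
    v + |f q - f p| ∈ chainVariations f q := by
  obtain ⟨n, c, hc, rfl, rfl⟩ := hv
  refine ⟨n + 1, fun i => if i ≤ n then c i else q, fun i hi => ?_, by simp, ?_⟩
  · rcases Nat.lt_succ_iff_lt_or_eq.mp hi with h | rfl
    · simpa [h.le, Nat.succ_le_of_lt h] using hc i h
    · simpa using hpq
  · rw [Finset.sum_range_succ]
    congr 1
    · refine Finset.sum_congr rfl fun j hj => ?_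
      have h := Finset.mem_range.mp hj
      simp [h.le, Nat.succ_le_of_lt h]
    · simp

theorem sSup_chainVariations_add_le {P : Type*} [Preorder P] {f : P → ℝ} {p q : P}
    (hq : BddAbove (chainVariations f q)) (hpq : p < q) :
    sSup (chainVariations f p) + |f q - f p| ≤ sSup (chainVariations f q) := by
  rw [← le_sub_iff_add_le]
  exact csSup_le ⟨0, zero_mem_chainVariations f p⟩ fun v hv =>
    le_sub_iff_add_le.mpr (le_csSup hq (add_abs_sub_mem_chainVariations hpq hv))

/-- A real-valued function on a poset whose variations along finite strictly
increasing chains ending at each point are bounded above is the difference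
of two antitone (order-reversing) functions. -/
theorem boundedVariation_diff_antitone {P : Type*} [PartialOrder P] (f : P → ℝ)
    (hbd : ∀ p : P, ∃ M : ℝ, ∀ n : ℕ, 1 ≤ n → ∀ c : ℕ → P,
      (∀ i < n, c i < c (i + 1)) → c n = p →
      ∑ j ∈ Finset.range n, |f (c (j + 1)) - f (c j)| ≤ M) :
    ∃ ν κ : P → ℝ, Antitone ν ∧ Antitone κ ∧ f = ν - κ := by
  have hb (p : P) : BddAbove (chainVariations f p) := by
    obtain ⟨M, hM⟩ := hbd p
    refine ⟨max M 0, ?_⟩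
    rintro _ ⟨n, c, hc, hp, rfl⟩
    rcases Nat.eq_zero_or_pos n with rfl | hn
    · simp
    · exact (hM n hn c hc hp).trans (le_max_left _ _)
  have key {p q : P} (hpq : p ≤ q) :
      sSup (chainVariations f p) + |f q - f p| ≤ sSup (chainVariations f q) := by
    rcases hpq.eq_or_lt with rfl | h
    · simp
    · exact sSup_chainVariations_add_le (hb q) h
  refine ⟨fun p => f p - sSup (chainVariations f p), fun p => -sSup (chainVariations f p),
    fun p q hpq => ?_, fun p q hpq => ?_, ?_⟩
  · linarith [key hpq, le_abs_self (f q - f p)]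
  · linarith [key hpq, abs_nonneg (f q - f p)]
  · ext p
    simp
end
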